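/- Static CVaR upper bound: for every risk-dependent policy π̃, every initial risk level α ∈ (0,1], and every choice of minimizing family ξ̃⋆ defining the induced history-dependent policy π̃_h^α, the static CVaR of the induced policy is at most the risk-dependent value function at the initial state: CVaR_α[Z^{π̃_h^α}] ≤ V^{π̃}(s₀, α). -/

import Mathlib

open Finset

section CVaRDefs

attribute [local instance] Classical.propDecidable

variable {S A : Type*}

/-- Risk envelope `U_y(p)` for a pmf `p` on a finite type `Ω`. -/
def RiskEnv {Ω : Type*} [Fintype Ω] (y : ℝ) (p : Ω → ℝ) (ξ : Ω → ℝ) : Prop :=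
  (∀ ω, 0 ≤ ξ ω ∧ ξ ω ≤ 1 / y) ∧ ∑ ω, p ω * ξ ω = 1

/-- State at time `k` along a history `H` starting from `s`
    (a history records, at each step, the action taken and the next state). -/
def stAt (s : S) {t : ℕ} (H : Fin t → A × S) : ℕ → S
  | 0 => s
  | k + 1 => if h : k < t then (H ⟨k, h⟩).2 else s

/-- Length-`k` prefix of a history (junk values beyond `t`). -/
noncomputable def pre [Nonempty S] [Nonempty A] {t : ℕ} (H : Fin t → A × S) (k : ℕ) :
    Fin k → A × S :=
  fun i => if h : (i : ℕ) < t then H ⟨i, h⟩ else Classical.arbitrary _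

/-- Deterministic history-dependent policies. -/
abbrev HPolicy (S A : Type*) := ∀ k : ℕ, (Fin k → A × S) → A

/-- Probability of history `H` under transition kernel `P` and policy `πh`, starting from `s`. -/
noncomputable def histProb [Nonempty S] [Nonempty A] (P : S → A → S → ℝ) (s : S)
    (πh : HPolicy S A) {t : ℕ} (H : Fin t → A × S) : ℝ :=
  ∏ k : Fin t,
    P (stAt s H k) (H k).1 (H k).2 * (if (H k).1 = πh k (pre H k) then 1 else 0)

/-- Discounted return of history `H` starting from `s`. -/
def ret (R : S → A → S → ℝ) (γ : ℝ) (s : S) {t : ℕ} (H : Fin t → A × S) : ℝ :=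
  ∑ k : Fin t, γ ^ (k : ℕ) * R (stAt s H k) (H k).1 (H k).2

/-- Static CVaR of a history-dependent policy at level `α` (dual formulation). -/
noncomputable def staticCVaR [Fintype S] [Fintype A] [Nonempty S] [Nonempty A]
    (P R : S → A → S → ℝ) (γ : ℝ) (s : S) (T : ℕ) (πh : HPolicy S A) (α : ℝ) : ℝ :=
  sInf {x | ∃ ξ : (Fin T → A × S) → ℝ,
    RiskEnv α (fun H => histProb P s πh H) ξ ∧
    x = ∑ H : Fin T → A × S, histProb P s πh H * ξ H * ret R γ s H}

/-- A valid state-level perturbation family (with the convention `ξ̃(·|s,0,a) ≡ 1`). -/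
def ValidFamily [Fintype S] (P : S → A → S → ℝ) (ξt : S → ℝ → A → S → ℝ) : Prop :=
  (∀ s y a, 0 < y → y ≤ 1 → RiskEnv y (P s a) (ξt s y a)) ∧
  ∀ s a s', ξt s 0 a s' = 1

/-- Policy–perturbation value function `V^{π̃,ξ̃}_t`. -/
def Vxi [Fintype S] (P R : S → A → S → ℝ) (γ : ℝ) (πt : S → ℝ → A)
    (ξt : S → ℝ → A → S → ℝ) : ℕ → S → ℝ → ℝ
  | 0, _, _ => 0
  | t + 1, s, y =>
    ∑ s' : S, P s (πt s y) s' * ξt s y (πt s y) s' *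
      (R s (πt s y) s' + γ * Vxi P R γ πt ξt t s' (y * ξt s y (πt s y) s'))

/-- Risk-dependent value function `V^{π̃}_t` (dynamic-programming CVaR evaluation). -/
noncomputable def Vdp [Fintype S] (P R : S → A → S → ℝ) (γ : ℝ) (πt : S → ℝ → A) :
    ℕ → S → ℝ → ℝ
  | 0, _, _ => 0
  | t + 1, s, y =>
    sInf {x | ∃ ξ : S → ℝ, RiskEnv y (P s (πt s y)) ξ ∧
      x = ∑ s' : S, P s (πt s y) s' * ξ s' *
        (R s (πt s y) s' + γ * Vdp P R γ πt t s' (y * ξ s'))}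

/-- Risk level `Y_k` at time `k` along history `H`, starting from `Y₀ = α`. -/
def riskAt (ξt : S → ℝ → A → S → ℝ) (s : S) (α : ℝ) {t : ℕ} (H : Fin t → A × S) :
    ℕ → ℝ
  | 0 => α
  | k + 1 =>
    riskAt ξt s α H k *
      if h : k < t then ξt (stAt s H k) (riskAt ξt s α H k) (H ⟨k, h⟩).1 (H ⟨k, h⟩).2 else 1

/-- Mapped history perturbation `ζ_α^{ξ̃}`. -/
def zeta (ξt : S → ℝ → A → S → ℝ) (s : S) (α : ℝ) {t : ℕ} (H : Fin t → A × S) : ℝ :=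
  ∏ k : Fin t, ξt (stAt s H k) (riskAt ξt s α H k) (H k).1 (H k).2

/-- History-dependent policy induced by `(π̃, ξ̃, α)` from initial state `s`. -/
def inducedPolicy (πt : S → ℝ → A) (ξt : S → ℝ → A → S → ℝ) (s : S) (α : ℝ) :
    HPolicy S A :=
  fun k H => πt (stAt s H k) (riskAt ξt s α H k)

/-- `ξ̃` attains the minima in the risk-dependent value recursion (at every augmented state). -/
def AttainsMin [Fintype S] (P R : S → A → S → ℝ) (γ : ℝ) (πt : S → ℝ → A)
    (ξt : S → ℝ → A → S → ℝ) : Prop :=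
  ∀ t : ℕ, ∀ s : S, ∀ y : ℝ, 0 < y → y ≤ 1 →
    Vdp P R γ πt (t + 1) s y =
      ∑ s' : S, P s (πt s y) s' * ξt s y (πt s y) s' *
        (R s (πt s y) s' + γ * Vdp P R γ πt t s' (y * ξt s y (πt s y) s'))

/-- Risk-propagation and state-level-envelope constraints of a risk-level assignment `Y`
    with respect to policy `πh`, initial level `α`, and history perturbation `ξ`. -/
def StructConsistent [Fintype S] [Fintype A] [Nonempty S] [Nonempty A]
    (P : S → A → S → ℝ) (s0 : S) (T : ℕ) (πh : HPolicy S A) (α : ℝ)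
    (ξ : (Fin T → A × S) → ℝ) (Y : ∀ k : ℕ, (Fin k → A × S) → ℝ) : Prop :=
  ∀ H : Fin T → A × S, 0 < histProb P s0 πh H →
    (Y 0 (pre H 0) = α ∧ Y T H = α * ξ H) ∧
    ∀ t : ℕ, ∀ ht : t < T,
      ∑ s' : S, P (stAt s0 H t) (H ⟨t, ht⟩).1 s' *
        (Y (t + 1) (Fin.snoc (pre H t) ((H ⟨t, ht⟩).1, s')) / Y t (pre H t)) = 1

/-- Action-selection consistency constraints of a risk-level assignment `Y` with respect to the
    risk-dependent policy `πt` along positive-probability histories of `πh`. -/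
def ActionConsistent [Fintype S] [Fintype A] [Nonempty S] [Nonempty A]
    (P : S → A → S → ℝ) (s0 : S) (T : ℕ) (πh : HPolicy S A)
    (πt : S → ℝ → A) (Y : ∀ k : ℕ, (Fin k → A × S) → ℝ) : Prop :=
  ∀ H : Fin T → A × S, 0 < histProb P s0 πh H →
    ∀ t : ℕ, ∀ ht : t < T, πt (stAt s0 H t) (Y t (pre H t)) = (H ⟨t, ht⟩).1

end CVaRDefs

section helpers

variable {S A : Type*}

lemma stAt_cons (s : S) {t : ℕ} (x : A × S) (H : Fin t → A × S) (k : ℕ) (hk : k ≤ t) :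
    stAt s (Fin.cons x H : Fin (t+1) → A × S) (k+1) = stAt x.2 H k := by
  cases k with
  | zero => simp [stAt]
  | succ k =>
    have h1 : k + 1 < t + 1 := by omega
    have h2 : k < t := by omega
    simp only [stAt, h1, h2, dif_pos]
    rfl

lemma riskAt_cons (ξt : S → ℝ → A → S → ℝ) (s : S) (y : ℝ) {t : ℕ} (x : A × S)
    (H : Fin t → A × S) (k : ℕ) (hk : k ≤ t) :
    riskAt ξt s y (Fin.cons x H : Fin (t+1) → A × S) (k+1)
      = riskAt ξt x.2 (y * ξt s y x.1 x.2) H k := by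
  induction k with
  | zero => simp [riskAt, stAt]
  | succ k ih =>
    have h1 : k + 1 < t + 1 := by omega
    have h2 : k < t := by omega
    rw [riskAt, ih (by omega), stAt_cons _ _ _ _ (by omega)]
    simp only [riskAt, h1, h2, dif_pos]
    rfl

lemma stAt_pre [Nonempty S] [Nonempty A] (s : S) {t : ℕ} (H : Fin t → A × S) (n k : ℕ)
    (hk : k ≤ n) (hn : n ≤ t) : stAt s (pre H n) k = stAt s H k := by
  cases k with
  | zero => rfl
  | succ k =>
    have h1 : k < n := by omega
    have h2 : k < t := by omega
    simp [stAt, h1, h2, pre]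

lemma riskAt_pre [Nonempty S] [Nonempty A] (ξt : S → ℝ → A → S → ℝ) (s : S) (y : ℝ) {t : ℕ}
    (H : Fin t → A × S) (n k : ℕ)
    (hk : k ≤ n) (hn : n ≤ t) : riskAt ξt s y (pre H n) k = riskAt ξt s y H k := by
  induction k with
  | zero => rfl
  | succ k ih =>
    have h1 : k < n := by omega
    have h2 : k < t := by omega
    simp only [riskAt, ih (by omega), stAt_pre s H n k (by omega) hn, h1, h2, dif_pos]
    simp [pre, h2]

lemma histProb_induced [Nonempty S] [Nonempty A] (P : S → A → S → ℝ)
    (πt : S → ℝ → A) (ξt : S → ℝ → A → S → ℝ) (s : S) (y : ℝ) {t : ℕ} (H : Fin t → A × S) :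
    histProb P s (inducedPolicy πt ξt s y) H =
      ∏ k : Fin t, P (stAt s H k) (H k).1 (H k).2 *
        (open Classical in if (H k).1 = πt (stAt s H k) (riskAt ξt s y H k) then 1 else 0) := by
  unfold histProb inducedPolicy
  refine Finset.prod_congr rfl fun k _ => ?_
  rw [stAt_pre s H k k le_rfl k.2.le, riskAt_pre ξt s y H k k le_rfl k.2.le]

lemma histProb_cons [Nonempty S] [Nonempty A] (P : S → A → S → ℝ)
    (πt : S → ℝ → A) (ξt : S → ℝ → A → S → ℝ) (s : S) (y : ℝ) {t : ℕ} (x : A × S)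
    (H : Fin t → A × S) :
    histProb P s (inducedPolicy πt ξt s y) (Fin.cons x H : Fin (t+1) → A × S) =
      (P s x.1 x.2 * (open Classical in if x.1 = πt s y then 1 else 0)) *
      histProb P x.2 (inducedPolicy πt ξt x.2 (y * ξt s y x.1 x.2)) H := by
  rw [histProb_induced, histProb_induced, Fin.prod_univ_succ]
  congr 1
  refine Finset.prod_congr rfl fun k _ => ?_
  rw [Fin.val_succ, stAt_cons _ _ _ _ k.2.le, riskAt_cons _ _ _ _ _ _ k.2.le, Fin.cons_succ]

lemma zeta_cons (ξt : S → ℝ → A → S → ℝ) (s : S) (y : ℝ) {t : ℕ} (x : A × S)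
    (H : Fin t → A × S) :
    zeta ξt s y (Fin.cons x H : Fin (t+1) → A × S) =
      ξt s y x.1 x.2 * zeta ξt x.2 (y * ξt s y x.1 x.2) H := by
  unfold zeta
  rw [Fin.prod_univ_succ]
  congr 1
  refine Finset.prod_congr rfl fun k _ => ?_
  rw [Fin.val_succ, stAt_cons _ _ _ _ k.2.le, riskAt_cons _ _ _ _ _ _ k.2.le, Fin.cons_succ]

lemma ret_cons (R : S → A → S → ℝ) (γ : ℝ) (s : S) {t : ℕ} (x : A × S)
    (H : Fin t → A × S) :
    ret R γ s (Fin.cons x H : Fin (t+1) → A × S) = R s x.1 x.2 + γ * ret R γ x.2 H := by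
  unfold ret
  rw [Fin.sum_univ_succ, Finset.mul_sum]
  congr 1
  · simp [stAt]
  refine Finset.sum_congr rfl fun k _ => ?_
  rw [Fin.val_succ, stAt_cons _ _ _ _ k.2.le, Fin.cons_succ]
  ring

lemma sum_hist_cons [Fintype S] [Fintype A] {t : ℕ} (F : (Fin (t+1) → A × S) → ℝ) :
    ∑ H, F H = ∑ a : A, ∑ s' : S, ∑ H : Fin t → A × S, F (Fin.cons (a, s') H) := by
  rw [← (Fin.consEquiv (fun _ : Fin (t+1) => A × S)).sum_comp, Fintype.sum_prod_type,
    Fintype.sum_prod_type]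
  rfl

/-- Sum over histories of an induced policy, one step unrolled. -/
lemma sum_hist_succ [Fintype S] [Fintype A] [Nonempty S] [Nonempty A] (P : S → A → S → ℝ)
    (πt : S → ℝ → A) (ξt : S → ℝ → A → S → ℝ) (s : S) (y : ℝ) {t : ℕ}
    (F : (Fin (t+1) → A × S) → ℝ) :
    ∑ H, histProb P s (inducedPolicy πt ξt s y) H * zeta ξt s y H * F H =
      ∑ s' : S, P s (πt s y) s' * ξt s y (πt s y) s' *
        ∑ H : Fin t → A × S,
          histProb P s' (inducedPolicy πt ξt s' (y * ξt s y (πt s y) s')) H *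
          zeta ξt s' (y * ξt s y (πt s y) s') H * F (Fin.cons (πt s y, s') H) := by
  rw [sum_hist_cons, Finset.sum_eq_single (πt s y)]
  · refine Finset.sum_congr rfl fun s' _ => ?_
    rw [Finset.mul_sum]
    refine Finset.sum_congr rfl fun H _ => ?_
    rw [histProb_cons, zeta_cons]
    simp only [if_true]
    ring
  · intro a _ ha
    refine Finset.sum_eq_zero fun s' _ => Finset.sum_eq_zero fun H _ => ?_
    rw [histProb_cons]
    simp [ha]
  · simp

lemma step_mem [Fintype S] {P : S → A → S → ℝ} {ξt : S → ℝ → A → S → ℝ}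
    (hvalid : ValidFamily P ξt) (s : S) (y : ℝ) (a : A) (s' : S) (h0 : 0 ≤ y) (h1 : y ≤ 1) :
    0 ≤ ξt s y a s' ∧ 0 ≤ y * ξt s y a s' ∧ y * ξt s y a s' ≤ 1 := by
  rcases h0.eq_or_lt with rfl | hy
  · simp [hvalid.2]
  · obtain ⟨h2, h3⟩ := (hvalid.1 s y a hy h1).1 s'
    refine ⟨h2, mul_nonneg h0 h2, ?_⟩
    rw [le_div_iff₀ hy] at h3
    linarith

lemma zeta_bounds [Fintype S] {P : S → A → S → ℝ} {ξt : S → ℝ → A → S → ℝ}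
    (hvalid : ValidFamily P ξt) (t : ℕ) : ∀ (s : S) (y : ℝ) (H : Fin t → A × S),
    0 ≤ y → y ≤ 1 → 0 ≤ zeta ξt s y H ∧ y * zeta ξt s y H ≤ 1 := by
  induction t with
  | zero => intro s y H h0 h1; simp [zeta, h1]
  | succ t ih =>
    intro s y H h0 h1
    obtain ⟨x, H, rfl⟩ : ∃ x H', H = Fin.cons x H' := ⟨H 0, Fin.tail H, (Fin.cons_self_tail H).symm⟩
    obtain ⟨h2, h3, h4⟩ := step_mem hvalid s y x.1 x.2 h0 h1
    obtain ⟨h5, h6⟩ := ih x.2 _ H h3 h4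
    rw [zeta_cons]
    exact ⟨mul_nonneg h2 h5, by rw [← mul_assoc]; exact h6⟩

lemma sum_zeta [Fintype S] [Fintype A] [Nonempty S] [Nonempty A] {P : S → A → S → ℝ}
    (hP : ∀ s a, (∀ s', 0 ≤ P s a s') ∧ ∑ s', P s a s' = 1)
    (πt : S → ℝ → A) {ξt : S → ℝ → A → S → ℝ}
    (hvalid : ValidFamily P ξt) (t : ℕ) : ∀ (s : S) (y : ℝ), 0 ≤ y → y ≤ 1 →
    ∑ H : Fin t → A × S, histProb P s (inducedPolicy πt ξt s y) H * zeta ξt s y H = 1 := by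
  induction t with
  | zero => intro s y h0 h1; simp [zeta, histProb]
  | succ t ih =>
    intro s y h0 h1
    have h := sum_hist_succ P πt ξt s y (t := t) (fun _ => 1)
    simp only [mul_one] at h
    rw [h]
    have : ∀ s' : S, P s (πt s y) s' * ξt s y (πt s y) s' *
        ∑ H : Fin t → A × S,
          histProb P s' (inducedPolicy πt ξt s' (y * ξt s y (πt s y) s')) H *
          zeta ξt s' (y * ξt s y (πt s y) s') H = P s (πt s y) s' * ξt s y (πt s y) s' := by
      intro s'
      obtain ⟨_, h3, h4⟩ := step_mem hvalid s y (πt s y) s' h0 h1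
      rw [ih s' _ h3 h4, mul_one]
    simp only [this]
    rcases h0.eq_or_lt with rfl | hy
    · simp [hvalid.2, (hP _ _).2]
    · exact (hvalid.1 s y _ hy h1).2

lemma sum_value [Fintype S] [Fintype A] [Nonempty S] [Nonempty A] {P R : S → A → S → ℝ} {γ : ℝ}
    (hP : ∀ s a, (∀ s', 0 ≤ P s a s') ∧ ∑ s', P s a s' = 1)
    {πt : S → ℝ → A} {ξt : S → ℝ → A → S → ℝ}
    (hvalid : ValidFamily P ξt) (hmin : AttainsMin P R γ πt ξt) (t : ℕ) :
    ∀ (s : S) (y : ℝ), 0 < y → y ≤ 1 →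
    ∑ H : Fin t → A × S, histProb P s (inducedPolicy πt ξt s y) H * zeta ξt s y H * ret R γ s H
      = Vdp P R γ πt t s y := by
  induction t with
  | zero => intro s y h0 h1; simp [ret, Vdp]
  | succ t ih =>
    intro s y h0 h1
    rw [sum_hist_succ, hmin t s y h0 h1]
    refine Finset.sum_congr rfl fun s' _ => ?_
    obtain ⟨h2, h3, h4⟩ := step_mem hvalid s y (πt s y) s' h0.le h1
    rcases h2.eq_or_lt with h | h
    · rw [← h]; simp
    · congr 1
      rw [← ih s' _ (mul_pos h0 h) h4, Finset.mul_sum]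
      have h5 := sum_zeta hP πt hvalid t s' _ h3 h4
      rw [← mul_one (R s (πt s y) s'), ← h5, Finset.mul_sum, ← Finset.sum_add_distrib]
      refine Finset.sum_congr rfl fun H _ => ?_
      rw [ret_cons]
      ring

end helpers

/-- static CVaR upper bound:
for every risk-dependent policy `π̃`, every initial risk level `α ∈ (0,1]`, and every choice
of minimizing family `ξ̃⋆` defining the induced history-dependent policy `π̃_h^α`,
the static CVaR of the induced policy is at most the risk-dependent value function at the
initial state: `CVaR_α[Z^{π̃_h^α}] ≤ V^{π̃}(s₀, α)`. -/
theorem stmt4 {S A : Type*} [Fintype S] [Fintype A] [Nonempty S] [Nonempty A]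
    (P R : S → A → S → ℝ) (γ : ℝ) (hγ0 : 0 < γ) (hγ1 : γ ≤ 1)
    (hP : ∀ s a, (∀ s', 0 ≤ P s a s') ∧ ∑ s', P s a s' = 1)
    (s0 : S) (T : ℕ) (πt : S → ℝ → A)
    (ξtstar : S → ℝ → A → S → ℝ)
    (hvalid : ValidFamily P ξtstar) (hmin : AttainsMin P R γ πt ξtstar)
    (α : ℝ) (hα0 : 0 < α) (hα1 : α ≤ 1) :
    staticCVaR P R γ s0 T (inducedPolicy πt ξtstar s0 α) α ≤ Vdp P R γ πt T s0 α := by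
  refine csInf_le ?_ ⟨fun H => zeta ξtstar s0 α H, ⟨fun H => ?_, ?_⟩, ?_⟩
  · refine ⟨∑ H : Fin T → A × S, -(|histProb P s0 (inducedPolicy πt ξtstar s0 α) H| * (1 / α) *
      |ret R γ s0 H|), ?_⟩
    rintro x ⟨ξ, hξ, rfl⟩
    refine Finset.sum_le_sum fun H _ => ?_
    obtain ⟨h1, h2⟩ := hξ.1 H
    refine le_trans ?_ (neg_abs_le _)
    rw [abs_mul, abs_mul, abs_of_nonneg h1]
    gcongr
  · obtain ⟨h1, h2⟩ := zeta_bounds hvalid T s0 α H hα0.le hα1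
    refine ⟨h1, ?_⟩
    rw [le_div_iff₀ hα0]
    linarith
  · exact sum_zeta hP πt hvalid T s0 α hα0.le hα1
  · exact (sum_value hP hvalid hmin T s0 α hα0 hα1).symm
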